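/- Let μ be a product probability measure on the unit cube [0,1]^n whose coordinate marginals have means m_k and variances σ_k² with σ_k² > σ_0² > 0 for all k, let x̄ = (m_1,…,m_n), R_0² = Σ_k σ_k², and let x_1, …, x_M be i.i.d. random points with law μ. Then P( 1/2 ≤ ‖x_j − x̄‖²/R_0² ≤ 3/2 for all j, and ((x_i − x̄)/R_0, (x_j − x̄)/‖x_j − x̄‖) < √2/2 for all i ≠ j ) ≥ 1 − M(M+1)·exp(−0.5·n·σ_0⁴). -/

import Mathlib

open MeasureTheory ProbabilityTheory

/-- **Hoeffding's inequality** for a weighted sum of independent `[0,1]`-valued variables. -/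
lemma measureReal_pi_weighted_sum_ge_le {ι : Type*} [Fintype ι] {Ω : ι → Type*}
    [∀ k, MeasurableSpace (Ω k)] (ν : ∀ k, Measure (Ω k)) [∀ k, IsProbabilityMeasure (ν k)]
    (f : ∀ k, Ω k → ℝ) (hf : ∀ k, AEMeasurable (f k) (ν k))
    (hf01 : ∀ k, ∀ᵐ t ∂(ν k), f k t ∈ Set.Icc (0 : ℝ) 1)
    (r : ι → ℝ) {ε : ℝ} (hε : 0 ≤ ε) :
    (Measure.pi ν).real {x | ε ≤ ∑ k, r k * (f k (x k) - ∫ t, f k t ∂(ν k))}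
      ≤ Real.exp (-(2 * ε ^ 2) / ∑ k, r k ^ 2) := by
  have hsub : ∀ k, HasSubgaussianMGF (fun t ↦ r k * (f k t - ∫ s, f k s ∂(ν k)))
      (⟨r k ^ 2, sq_nonneg (r k)⟩ * (‖(1 : ℝ) - 0‖₊ / 2) ^ 2) (ν k) := fun k ↦
    (hasSubgaussianMGF_of_mem_Icc (hf k) (hf01 k)).const_mul (r k)
  have hindep : iIndepFun (fun k (x : ∀ k, Ω k) ↦ r k * (f k (x k) - ∫ s, f k s ∂(ν k)))
      (Measure.pi ν) :=
    iIndepFun_pi (X := fun k t ↦ r k * (f k t - ∫ s, f k s ∂(ν k))) fun k ↦ (hsub k).aemeasurable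
  have hsub' : ∀ k ∈ Finset.univ, HasSubgaussianMGF
      (fun x : ∀ k, Ω k ↦ r k * (f k (x k) - ∫ s, f k s ∂(ν k)))
      (⟨r k ^ 2, sq_nonneg (r k)⟩ * (‖(1 : ℝ) - 0‖₊ / 2) ^ 2) (Measure.pi ν) := fun k _ ↦
    HasSubgaussianMGF.of_map (Y := fun x : ∀ k, Ω k ↦ x k)
      (X := fun t ↦ r k * (f k t - ∫ s, f k s ∂(ν k))) (measurable_pi_apply k).aemeasurable
      (by rw [(measurePreserving_eval ν k).map_eq]; exact hsub k)
  refine (HasSubgaussianMGF.measure_sum_ge_le_of_iIndepFun hindep hsub' hε).trans_eq ?_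
  congr 1
  have hsum : ((∑ k, (⟨r k ^ 2, sq_nonneg (r k)⟩ * (‖(1 : ℝ) - 0‖₊ / 2) ^ 2 : NNReal) : NNReal) : ℝ)
      = (∑ k, r k ^ 2) / 4 := by
    push_cast
    rw [Finset.sum_div]
    refine Finset.sum_congr rfl fun k _ ↦ ?_
    change r k ^ 2 * (‖(1 : ℝ) - 0‖ / 2) ^ 2 = r k ^ 2 / 4
    rw [sub_zero, norm_one]
    ring
  push_cast at hsum ⊢
  rw [hsum]
  rcases eq_or_ne (∑ k, r k ^ 2) 0 with h | h
  · simp [h]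
  · field_simp
    ring

/-- If every second-coordinate section of a measurable set has probability at most `b`, then so
does the event that a pair of distinct independent coordinates lies in it. -/
lemma measure_pi_pair_mem_le {ι α : Type*} [Fintype ι] [MeasurableSpace α] (μ : Measure α)
    [IsProbabilityMeasure μ] {s : Set (α × α)} (hs : MeasurableSet s) {b : ENNReal}
    (hb : ∀ y, μ {x | (x, y) ∈ s} ≤ b) {i j : ι} (hij : i ≠ j) :
    (Measure.pi fun _ : ι ↦ μ) {x | (x i, x j) ∈ s} ≤ b := by
  have hind : IndepFun (fun x : ι → α ↦ x i) (fun x ↦ x j) (Measure.pi fun _ : ι ↦ μ) :=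
    (iIndepFun_pi (μ := fun _ : ι ↦ μ) (X := fun _ x ↦ x) fun _ ↦ aemeasurable_id).indepFun hij
  have hmap := (indepFun_iff_map_prod_eq_prod_map_map (measurable_pi_apply i).aemeasurable
    (measurable_pi_apply j).aemeasurable).1 hind
  have hi : (Measure.pi fun _ : ι ↦ μ).map (fun x ↦ x i) = μ :=
    (measurePreserving_eval (fun _ : ι ↦ μ) i).map_eq
  have hj : (Measure.pi fun _ : ι ↦ μ).map (fun x ↦ x j) = μ :=
    (measurePreserving_eval (fun _ : ι ↦ μ) j).map_eq
  rw [hi, hj] at hmap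
  have hmeas : Measurable fun x : ι → α ↦ (x i, x j) := by fun_prop
  calc (Measure.pi fun _ : ι ↦ μ) {x | (x i, x j) ∈ s}
      = (μ.prod μ) s := by rw [← hmap, Measure.map_apply hmeas hs]; rfl
    _ = ∫⁻ y, μ {x | (x, y) ∈ s} ∂μ := Measure.prod_apply_symm hs
    _ ≤ ∫⁻ _, b ∂μ := lintegral_mono hb
    _ = b := by simp

/-- The squared distance to the mean of a random point of the cube leaves
`[∑ σₖ² / 2, 3 ∑ σₖ² / 2]` with exponentially small probability. -/
lemma measureReal_pi_norm_sq_deviation_le {ι : Type*} [Fintype ι] (ν : ι → Measure ℝ)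
    [∀ k, IsProbabilityMeasure (ν k)] (hν : ∀ k, ∀ᵐ t ∂(ν k), t ∈ Set.Icc (0 : ℝ) 1)
    {m : ι → ℝ} (hm : ∀ k, m k ∈ Set.Icc (0 : ℝ) 1) {R : ℝ}
    (hR : R = ∑ k, ∫ t, (t - m k) ^ 2 ∂(ν k)) (hR0 : 0 < R) :
    (Measure.pi ν).real {x | ¬ (1 / 2 ≤ (∑ k, (x k - m k) ^ 2) / R ∧
      (∑ k, (x k - m k) ^ 2) / R ≤ 3 / 2)}
      ≤ 2 * Real.exp (-(R ^ 2) / (2 * Fintype.card ι)) := by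
  have hsq : ∀ k, ∀ᵐ t ∂(ν k), (t - m k) ^ 2 ∈ Set.Icc (0 : ℝ) 1 := by
    intro k
    filter_upwards [hν k] with t ht
    obtain ⟨h0, h1⟩ := hm k
    obtain ⟨h2, h3⟩ := ht
    exact ⟨sq_nonneg _, by rw [sq_le_one_iff_abs_le_one, abs_le]; constructor <;> linarith⟩
  have key := fun (r : ℝ) ↦ measureReal_pi_weighted_sum_ge_le ν (fun k t ↦ (t - m k) ^ 2)
    (fun k ↦ by fun_prop) hsq (fun _ ↦ r) (half_pos hR0).le
  have hsum : ∀ (r : ℝ) (x : ι → ℝ), ∑ k, r * ((x k - m k) ^ 2 - ∫ t, (t - m k) ^ 2 ∂(ν k))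
      = r * (∑ k, (x k - m k) ^ 2 - R) := by
    intro r x
    rw [hR, ← Finset.mul_sum, Finset.sum_sub_distrib]
  have hexp : -(2 * (R / 2) ^ 2) / (Fintype.card ι : ℝ) = -(R ^ 2) / (2 * Fintype.card ι) := by
    rcases eq_or_ne (Fintype.card ι : ℝ) 0 with h | h
    · simp [h]
    · field_simp
  have h1 := key 1
  have h2 := key (-1)
  simp only [hsum] at h1 h2
  norm_num only [Finset.sum_const, Finset.card_univ, nsmul_eq_mul, one_pow, mul_one, neg_sq]
    at h1 h2
  rw [hexp] at h1 h2
  rw [two_mul]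
  refine (measureReal_mono ?_).trans ((measureReal_union_le _ _).trans (add_le_add h1 h2))
  intro x hx
  rw [Set.mem_ofPred_eq, not_and_or, not_le, not_le, div_lt_iff₀ hR0, lt_div_iff₀ hR0] at hx
  rcases hx with hx | hx
  · right
    rw [Set.mem_ofPred_eq]
    linarith
  · left
    rw [Set.mem_ofPred_eq]
    linarith

/-- The normalized inner product of a random point of the cube, centred at its mean, with a fixed
direction is at least `√2 / 2` with probability at most `exp (-R)`. -/
lemma measureReal_pi_inner_direction_ge_le {ι : Type*} [Fintype ι] (ν : ι → Measure ℝ)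
    [∀ k, IsProbabilityMeasure (ν k)] (hν : ∀ k, ∀ᵐ t ∂(ν k), t ∈ Set.Icc (0 : ℝ) 1)
    {m : ι → ℝ} (hm : ∀ k, m k = ∫ t, t ∂(ν k)) {R : ℝ} (hR0 : 0 < R) (v : ι → ℝ) :
    (Measure.pi ν).real {x | Real.sqrt 2 / 2 ≤
      ∑ k, ((x k - m k) / Real.sqrt R) * (v k / Real.sqrt (∑ l, v l ^ 2))}
      ≤ Real.exp (-R) := by
  have hv0 : 0 ≤ ∑ l, v l ^ 2 := Finset.sum_nonneg fun l _ ↦ sq_nonneg _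
  rcases hv0.eq_or_lt with hv | hv
  · have h2 : ¬ Real.sqrt 2 / 2 ≤ 0 := not_le.2 (by positivity)
    simp only [← hv, Real.sqrt_zero, div_zero, mul_zero, Finset.sum_const_zero, h2,
      Set.ofPred_false, measureReal_empty, Real.exp_nonneg]
  have key := measureReal_pi_weighted_sum_ge_le ν (fun _ t ↦ t) (fun k ↦ by fun_prop) hν
    (fun k ↦ v k / (Real.sqrt R * Real.sqrt (∑ l, v l ^ 2)))
    (ε := Real.sqrt 2 / 2) (by positivity)
  have hsum : ∑ k, (v k / (Real.sqrt R * Real.sqrt (∑ l, v l ^ 2))) ^ 2 = 1 / R := by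
    simp only [div_pow, mul_pow, Real.sq_sqrt hR0.le, Real.sq_sqrt hv0, ← Finset.sum_div]
    field_simp
  have hexp : -(2 * (Real.sqrt 2 / 2) ^ 2) / (1 / R) = -R := by
    rw [div_pow, Real.sq_sqrt zero_le_two]
    field_simp
  rw [hsum, hexp] at key
  convert key using 6 with x k
  rw [hm k]
  ring

/-- (Inequality (13).) Let `μ = ν₁ ⊗ … ⊗ νₙ` be a product probability
measure on `[0,1]ⁿ` with coordinate means `mₖ` and variances `σₖ² > σ₀² > 0`,
`R₀² = Σₖ σₖ²`, and let `x₁, …, x_M` be i.i.d. with law `μ`. Then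
`P(1/2 ≤ ‖xⱼ-x̄‖²/R₀² ≤ 3/2 for all j, and ((xᵢ-x̄)/R₀, (xⱼ-x̄)/‖xⱼ-x̄‖) < √2/2 for all
i ≠ j) ≥ 1 - M(M+1)·exp(-0.5nσ₀⁴)`. -/
theorem cube_separation_all_points_simplified
    (n M : ℕ) (hn : 1 ≤ n) (hM : 1 ≤ M)
    (ν : Fin n → Measure ℝ) [∀ k, IsProbabilityMeasure (ν k)]
    (hsupp : ∀ k, ν k (Set.Icc (0 : ℝ) 1)ᶜ = 0)
    (m : Fin n → ℝ) (hm : ∀ k, m k = ∫ t, t ∂(ν k))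
    (σ2 : Fin n → ℝ) (hσ2 : ∀ k, σ2 k = ∫ t, (t - m k) ^ 2 ∂(ν k))
    (σ0sq : ℝ) (hσ0pos : 0 < σ0sq) (hvar : ∀ k, σ0sq < σ2 k)
    (R0sq : ℝ) (hR0 : R0sq = ∑ k, σ2 k) :
    (Measure.pi fun _ : Fin M => Measure.pi ν)
      {x : Fin M → (Fin n → ℝ) |
        (∀ j, 1 / 2 ≤ (∑ k, (x j k - m k) ^ 2) / R0sq ∧
              (∑ k, (x j k - m k) ^ 2) / R0sq ≤ 3 / 2) ∧
        ∀ i j, i ≠ j →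
          (∑ k, ((x i k - m k) / Real.sqrt R0sq) *
              ((x j k - m k) / Real.sqrt (∑ k', (x j k' - m k') ^ 2)))
            < Real.sqrt 2 / 2}
      ≥ ENNReal.ofReal (1 - (M : ℝ) * ((M : ℝ) + 1) * Real.exp (-0.5 * n * σ0sq ^ 2)) := by
  have hν : ∀ k, ∀ᵐ t ∂(ν k), t ∈ Set.Icc (0 : ℝ) 1 := fun k ↦ mem_ae_iff.2 (hsupp k)
  have hm01 : ∀ k, m k ∈ Set.Icc (0 : ℝ) 1 := by
    intro k
    rw [hm k]
    exact (convex_Icc 0 1).integral_mem isClosed_Icc (hν k)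
      (Integrable.of_mem_Icc 0 1 aemeasurable_id (hν k))
  have hσ1 : ∀ k, σ2 k ≤ 1 := by
    intro k
    have hsq : ∀ᵐ t ∂(ν k), (t - m k) ^ 2 ∈ Set.Icc (0 : ℝ) 1 := by
      filter_upwards [hν k] with t ht
      obtain ⟨h0, h1⟩ := hm01 k
      obtain ⟨h2, h3⟩ := ht
      exact ⟨sq_nonneg _, by rw [sq_le_one_iff_abs_le_one, abs_le]; constructor <;> linarith⟩
    rw [hσ2 k]
    exact ((convex_Icc (0 : ℝ) 1).integral_mem isClosed_Icc hsq
      (Integrable.of_mem_Icc 0 1 (by fun_prop) hsq)).2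
  have hσ0 : σ0sq ≤ 1 := (hvar ⟨0, hn⟩).le.trans (hσ1 _)
  have hn' : (0 : ℝ) < n := by exact_mod_cast hn
  have hRn : n * σ0sq ≤ R0sq := by
    rw [hR0]
    simpa using Finset.card_nsmul_le_sum Finset.univ σ2 σ0sq fun k _ ↦ (hvar k).le
  have hRpos : 0 < R0sq := (mul_pos hn' hσ0pos).trans_le hRn
  set e : ℝ := Real.exp (-0.5 * n * σ0sq ^ 2) with he
  have he0 : 0 ≤ e := Real.exp_nonneg _
  have hnorm : Measure.pi ν {y | ¬ (1 / 2 ≤ (∑ k, (y k - m k) ^ 2) / R0sq ∧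
      (∑ k, (y k - m k) ^ 2) / R0sq ≤ 3 / 2)} ≤ ENNReal.ofReal (2 * e) := by
    rw [← ofReal_measureReal]
    refine ENNReal.ofReal_le_ofReal ((measureReal_pi_norm_sq_deviation_le ν hν hm01
      (by simp only [hR0, hσ2]) hRpos).trans ?_)
    have h1 : (n * σ0sq) ^ 2 ≤ R0sq ^ 2 := by gcongr
    have h2 : -R0sq ^ 2 / (2 * n) ≤ -0.5 * n * σ0sq ^ 2 := by
      rw [div_le_iff₀ (by positivity)]
      nlinarith
    simpa [he] using h2
  have hdir : ∀ v : Fin n → ℝ, Measure.pi ν {y | Real.sqrt 2 / 2 ≤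
      ∑ k, ((y k - m k) / Real.sqrt R0sq) * ((v k - m k) / Real.sqrt (∑ l, (v l - m l) ^ 2))}
      ≤ ENNReal.ofReal e := by
    intro v
    rw [← ofReal_measureReal]
    refine ENNReal.ofReal_le_ofReal ((measureReal_pi_inner_direction_ge_le ν hν hm hRpos
      fun k ↦ v k - m k).trans (Real.exp_le_exp.2 ?_))
    have h1 : σ0sq ^ 2 ≤ σ0sq := by nlinarith
    nlinarith [mul_le_mul_of_nonneg_left h1 hn'.le, mul_pos hn' hσ0pos]
  set P : Measure (Fin M → Fin n → ℝ) := Measure.pi fun _ : Fin M => Measure.pi ν with hP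
  set N : Set (Fin n → ℝ) := {y | ¬ (1 / 2 ≤ (∑ k, (y k - m k) ^ 2) / R0sq ∧
      (∑ k, (y k - m k) ^ 2) / R0sq ≤ 3 / 2)} with hN
  set D : Set ((Fin n → ℝ) × (Fin n → ℝ)) := {p | Real.sqrt 2 / 2 ≤
      ∑ k, ((p.1 k - m k) / Real.sqrt R0sq) *
        ((p.2 k - m k) / Real.sqrt (∑ l, (p.2 l - m l) ^ 2))} with hD
  have hNmeas : MeasurableSet N := by
    have h : Measurable fun y : Fin n → ℝ ↦ (∑ k, (y k - m k) ^ 2) / R0sq := by fun_prop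
    exact ((measurableSet_le measurable_const h).inter
      (measurableSet_le h measurable_const)).compl
  have hDmeas : MeasurableSet D := by
    refine measurableSet_le ?_ ?_ <;> fun_prop
  have hPN : ∀ j, P {x | x j ∈ N} ≤ ENNReal.ofReal (2 * e) := fun j ↦
    ((measurePreserving_eval (fun _ : Fin M ↦ Measure.pi ν) j).measure_preimage
      hNmeas.nullMeasurableSet).trans_le hnorm
  have hPD : ∀ p ∈ (Finset.univ : Finset (Fin M)).offDiag,
      P {x | (x p.1, x p.2) ∈ D} ≤ ENNReal.ofReal e := fun p hp ↦
    measure_pi_pair_mem_le _ hDmeas hdir (Finset.mem_offDiag.1 hp).2.2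
  set S : Set (Fin M → Fin n → ℝ) := _
  change P S ≥ _
  have hSc : Sᶜ ⊆ (⋃ j ∈ (Finset.univ : Finset (Fin M)), {x | x j ∈ N}) ∪
      ⋃ p ∈ (Finset.univ : Finset (Fin M)).offDiag, {x | (x p.1, x p.2) ∈ D} := by
    intro x hx
    by_contra hcon
    simp only [Set.mem_union, Set.mem_iUnion, not_or, not_exists] at hcon
    refine hx ⟨fun j ↦ not_not.1 (hcon.1 j (Finset.mem_univ j)), fun i j hij ↦ ?_⟩
    exact not_le.1 (hcon.2 (i, j) (by simpa using hij))
  have hPSc : P Sᶜ ≤ ENNReal.ofReal (M * (M + 1) * e) :=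
    calc P Sᶜ ≤ ∑ j : Fin M, P {x | x j ∈ N} +
          ∑ p ∈ (Finset.univ : Finset (Fin M)).offDiag, P {x | (x p.1, x p.2) ∈ D} :=
          (measure_mono hSc).trans ((measure_union_le _ _).trans
            (add_le_add (measure_biUnion_finset_le _ _) (measure_biUnion_finset_le _ _)))
      _ ≤ ∑ _j : Fin M, ENNReal.ofReal (2 * e) +
          ∑ _p ∈ (Finset.univ : Finset (Fin M)).offDiag, ENNReal.ofReal e :=
          add_le_add (Finset.sum_le_sum fun j _ ↦ hPN j) (Finset.sum_le_sum hPD)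
      _ = ENNReal.ofReal (M * (M + 1) * e) := by
          rw [← ENNReal.ofReal_sum_of_nonneg (fun _ _ ↦ by positivity),
            ← ENNReal.ofReal_sum_of_nonneg (fun _ _ ↦ he0),
            ← ENNReal.ofReal_add (Finset.sum_nonneg fun _ _ ↦ by positivity)
              (Finset.sum_nonneg fun _ _ ↦ he0)]
          congr 1
          have : M ≤ M * M := Nat.le_mul_self M
          simp only [Finset.sum_const, Finset.card_univ, Finset.offDiag_card, Fintype.card_fin,
            nsmul_eq_mul, Nat.cast_sub this]
          push_cast
          ring
  have htot : (1 : ENNReal) ≤ P S + P Sᶜ := by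
    rw [← measure_univ (μ := P), ← Set.union_compl_self S]
    exact measure_union_le _ _
  rw [ge_iff_le, ENNReal.ofReal_sub _ (by positivity), ENNReal.ofReal_one,
    tsub_le_iff_right]
  exact htot.trans (by gcongr)
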